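/- arXiv:2203.11245 — 5 statements merged into one kernel-verified Lean document; each statement's English description precedes it below -/
import Mathlib

section
/- For every signalling structure represented as a finite directed graph whose nodes are nonempty sets of systems, there is a compatible embedding into an acyclic spacetime with regions of at most two points: for every finite type S (the systems), every finite type N (the nodes), every assignment node : N → Set S with each node n nonempty, and every edge relation Ed : N → N → Prop, there exist a type T equipped with a partial order and an assignment 𝒫 : S → Finset T such that each region 𝒫 s is nonempty with cardinality at most 2, the regions 𝒫 s are pairwise disjoint for distinct systems, and for all nodes n₁ n₂ : N with a directed path from n₁ to n₂ (Relation.TransGen Ed n₁ n₂) there exist systems s₁ ∈ node n₁ and s₂ ∈ node n₂ and points p ∈ 𝒫 s₁, q ∈ 𝒫 s₂ with p < q. -/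
/-- The partial order on `S × Bool` in which every point of the layer `false` lies strictly
below every point of the layer `true`, and there are no other strict relations. -/
abbrev twoLayerOrder (S : Type*) : PartialOrder (S × Bool) where
  le a b := a = b ∨ (a.2 = false ∧ b.2 = true)
  le_refl _ := Or.inl rfl
  le_trans a b c := by
    rintro (rfl | ⟨h₁, h₂⟩) (rfl | ⟨h₃, h₄⟩) <;> simp_all
  le_antisymm a b := by
    rintro (rfl | ⟨h₁, h₂⟩) (h | ⟨h₃, h₄⟩) <;> simp_all

theorem twoLayerOrder_lt {S : Type*} (s t : S) :
    (twoLayerOrder S).lt (s, false) (t, true) := by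
  refine (@lt_iff_le_and_ne _ (twoLayerOrder S) _ _).2 ⟨Or.inr ⟨rfl, rfl⟩, ?_⟩
  simp

/-- **Theorem 1 (Embedding arbitrary, cyclic signalling relations in spacetime).**
For every signalling structure, represented as a finite directed graph whose nodes are
nonempty sets of systems, there exists an acyclic spacetime (a partially ordered set `T`)
and an embedding assigning to each system a nonempty region of at most two spacetime
points, with regions of distinct systems disjoint, such that whenever there is a directed
path between two nodes of the signalling structure, some pair of points in the
corresponding regions is strictly ordered (relativistic causality). -/
theorem embedding_of_signalling_structure
    (S N : Type) [Fintype S] [Fintype N]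
    (node : N → Set S) (hnode : ∀ n, (node n).Nonempty)
    (Ed : N → N → Prop) :
    ∃ (T : Type) (_ : PartialOrder T) (reg : S → Finset T),
      (∀ s, (reg s).Nonempty) ∧
      (∀ s, (reg s).card ≤ 2) ∧
      (∀ s₁ s₂ : S, s₁ ≠ s₂ → Disjoint (reg s₁) (reg s₂)) ∧
      (∀ n₁ n₂ : N, Relation.TransGen Ed n₁ n₂ →
        ∃ s₁ ∈ node n₁, ∃ s₂ ∈ node n₂, ∃ p ∈ reg s₁, ∃ q ∈ reg s₂, p < q) := by
  classical
  refine ⟨S × Bool, twoLayerOrder S, fun s => {(s, false), (s, true)}, ?_, ?_, ?_, ?_⟩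
  · intro s
    exact Finset.insert_nonempty _ _
  · intro s
    exact Finset.card_le_two
  · intro s₁ s₂ h
    simp [Ne.symm h]
  · intro n₁ n₂ _
    obtain ⟨s₁, h₁⟩ := hnode n₁
    obtain ⟨s₂, h₂⟩ := hnode n₂
    exact ⟨s₁, h₁, s₂, h₂, (s₁, false), by simp, (s₂, true), by simp,
      twoLayerOrder_lt s₁ s₂⟩
end

section
/- Every finite directed graph is the coarse-graining of a directed acyclic graph obtained by splitting each node into at most two copies (node-splitting construction from the proof of the embedding theorem): for every finite type V and every relation E : V → V → Prop there exists a relation E' : (V ⊕ V) → (V ⊕ V) → Prop such that (i) E' is acyclic, i.e. for all a : V ⊕ V, ¬ Relation.TransGen E' a a, and (ii) for all u v : V, E u v holds if and only if there exist a b : V ⊕ V with (a = Sum.inl u ∨ a = Sum.inr u), (b = Sum.inl v ∨ b = Sum.inr v), and E' a b. -/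
/-- **Node-splitting construction from the proof of the embedding theorem.**
Every finite directed graph is the coarse-graining of a directed acyclic graph obtained by
splitting each node into at most two copies: there is an acyclic relation `E'` on `V ⊕ V`
such that an edge `E u v` holds iff it is witnessed by an `E'`-edge between copies of `u`
and copies of `v`. -/
theorem exists_acyclic_fineGraining
    (V : Type*) [Fintype V] (E : V → V → Prop) :
    ∃ E' : (V ⊕ V) → (V ⊕ V) → Prop,
      (∀ a : V ⊕ V, ¬ Relation.TransGen E' a a) ∧
      (∀ u v : V, E u v ↔ ∃ a b : V ⊕ V,
        (a = Sum.inl u ∨ a = Sum.inr u) ∧ (b = Sum.inl v ∨ b = Sum.inr v) ∧ E' a b) := by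
  refine ⟨fun a b => ∃ u v, a = Sum.inl u ∧ b = Sum.inr v ∧ E u v, fun a h => ?_, fun u v => ?_⟩
  · obtain ⟨_, ⟨u, _, hu, _⟩, _⟩ := Relation.TransGen.head'_iff.mp h
    obtain ⟨_, _, ⟨_, v, _, hv, _⟩⟩ := Relation.TransGen.tail'_iff.mp h
    exact Sum.inl_ne_inr (hu.symm.trans hv)
  · constructor
    · exact fun h => ⟨_, _, Or.inl rfl, Or.inr rfl, u, v, rfl, rfl, h⟩
    · rintro ⟨_, _, ha, hb, _, _, rfl, rfl, h⟩
      simp_all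
end

section
/- Signalling can always be verified with product states (claim established in the necessity part of the proof of the signalling-equivalence theorem): Let α, β, κ be finite types with decidable equality and Φ : Matrix (α × β) (α × β) ℂ →ₗ[ℂ] Matrix κ κ ℂ a linear map. If there exist a density matrix σ on α × β and a density matrix ρ on α such that Φ σ ≠ Φ (ρ ⊗ₖ ptr_α σ), then there exist density matrices ρ₁, ρ₂ on α and a density matrix σ_B on β such that Φ (ρ₁ ⊗ₖ σ_B) ≠ Φ (ρ₂ ⊗ₖ σ_B). -/
open Matrix Kronecker ComplexOrder

/-- A density matrix: positive semidefinite with unit trace. -/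
def IsDensity {n : Type} [Fintype n] (ρ : Matrix n n ℂ) : Prop :=
  ρ.PosSemidef ∧ ρ.trace = 1

/-- Partial trace over the first tensor factor. -/
noncomputable def ptrFst {μ ν : Type} [Fintype μ]
    (M : Matrix (μ × ν) (μ × ν) ℂ) : Matrix ν ν ℂ :=
  Matrix.of fun o p => ∑ k : μ, M (k, o) (k, p)

section SpanDensity

open scoped MatrixOrder Matrix.Norms.L2Operator

/-- Density matrices span the full matrix algebra. -/
theorem span_isDensity {n : Type} [Fintype n] [DecidableEq n] :
    Submodule.span ℂ {ρ : Matrix n n ℂ | IsDensity ρ} = ⊤ := by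
  rw [eq_top_iff, ← CStarAlgebra.span_nonneg (A := Matrix n n ℂ), Submodule.span_le]
  intro A hA
  have hA : A.PosSemidef := Matrix.nonneg_iff_posSemidef.mp hA
  by_cases ht : A.trace = 0
  · rw [hA.trace_eq_zero_iff.mp ht]
    exact Submodule.zero_mem _
  · have hd : IsDensity (A.trace⁻¹ • A) :=
      ⟨hA.smul (inv_nonneg.mpr hA.trace_nonneg), by simp [Matrix.trace_smul, ht]⟩
    rw [← smul_inv_smul₀ ht A]
    exact Submodule.smul_mem _ _ (Submodule.subset_span hd)

end SpanDensity

theorem ptrFst_add {μ ν : Type} [Fintype μ] (M N : Matrix (μ × ν) (μ × ν) ℂ) :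
    ptrFst (M + N) = ptrFst M + ptrFst N := by
  ext o p
  simp [ptrFst, Finset.sum_add_distrib]

theorem ptrFst_kronecker {μ ν : Type} [Fintype μ] (A : Matrix μ μ ℂ) (B : Matrix ν ν ℂ) :
    ptrFst (A ⊗ₖ B) = A.trace • B := by
  ext o p
  simp [ptrFst, Matrix.trace, Finset.sum_mul]

/-- If no pair of product inputs differing only in the first factor can be distinguished,
then the first factor enters only through its trace. -/
theorem map_kronecker_eq_trace_smul {α β κ : Type} [Fintype α] [Fintype β]
    [DecidableEq α] [DecidableEq β]
    (Φ : Matrix (α × β) (α × β) ℂ →ₗ[ℂ] Matrix κ κ ℂ)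
    (h : ∀ ρ₁ ρ₂ : Matrix α α ℂ, IsDensity ρ₁ → IsDensity ρ₂ →
      ∀ σB : Matrix β β ℂ, IsDensity σB → Φ (ρ₁ ⊗ₖ σB) = Φ (ρ₂ ⊗ₖ σB))
    {ρ : Matrix α α ℂ} (hρ : IsDensity ρ) (A : Matrix α α ℂ) (B : Matrix β β ℂ) :
    Φ (A ⊗ₖ B) = A.trace • Φ (ρ ⊗ₖ B) := by
  have hB : B ∈ Submodule.span ℂ {σ : Matrix β β ℂ | IsDensity σ} := by
    simp [span_isDensity]
  have hA : A ∈ Submodule.span ℂ {σ : Matrix α α ℂ | IsDensity σ} := by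
    simp [span_isDensity]
  induction hA using Submodule.span_induction with
  | mem A hA =>
    rw [hA.2, one_smul]
    induction hB using Submodule.span_induction with
    | mem B hB => exact h A ρ hA hρ B hB
    | zero => simp
    | add X Y _ _ hX hY => simp [Matrix.kronecker_add, hX, hY]
    | smul c X _ hX => simp [Matrix.kronecker_smul, hX]
  | zero => simp
  | add X Y _ _ hX hY => simp [Matrix.add_kronecker, Matrix.trace_add, add_smul, hX, hY]
  | smul c X _ hX => simp [Matrix.smul_kronecker, Matrix.trace_smul, mul_smul, hX]

/-- **Signalling can always be verified with product states** (necessity part of the proof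
of the signalling-equivalence theorem): if the `α` subsystem signals through `Φ`, as
detected with a possibly entangled joint input `σ` and a replacement state `ρ`, then the
signalling is also detectable using only product input states. -/
theorem signalling_detectable_with_product_states
    {α β κ : Type} [Fintype α] [Fintype β] [Fintype κ]
    [DecidableEq α] [DecidableEq β] [DecidableEq κ]
    (Φ : Matrix (α × β) (α × β) ℂ →ₗ[ℂ] Matrix κ κ ℂ)
    (h : ∃ σ : Matrix (α × β) (α × β) ℂ, IsDensity σ ∧
      ∃ ρ : Matrix α α ℂ, IsDensity ρ ∧ Φ σ ≠ Φ (ρ ⊗ₖ ptrFst σ)) :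
    ∃ ρ₁ ρ₂ : Matrix α α ℂ, IsDensity ρ₁ ∧ IsDensity ρ₂ ∧
      ∃ σB : Matrix β β ℂ, IsDensity σB ∧ Φ (ρ₁ ⊗ₖ σB) ≠ Φ (ρ₂ ⊗ₖ σB) := by
  obtain ⟨σ, -, ρ, hρ, hne⟩ := h
  by_contra! hcon
  have key := map_kronecker_eq_trace_smul Φ
    (fun ρ₁ ρ₂ h₁ h₂ σB hσ => hcon ρ₁ ρ₂ h₁ h₂ σB hσ) hρ
  apply hne
  clear hne
  induction σ using Matrix.induction_on' with
  | h_zero =>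
    have : ptrFst (0 : Matrix (α × β) (α × β) ℂ) = 0 := by
      ext o p
      simp [ptrFst]
    simp [this]
  | h_add M N hM hN => simp [ptrFst_add, Matrix.kronecker_add, hM, hN]
  | h_std_basis i j x =>
    obtain ⟨a, b⟩ := i
    obtain ⟨c, d⟩ := j
    have hs : Matrix.single (a, b) (c, d) x =
        Matrix.single a c (1 : ℂ) ⊗ₖ Matrix.single b d x := by
      simp [Matrix.single_kronecker_single]
    rw [hs, ptrFst_kronecker, key, Matrix.kronecker_smul, map_smul]
end

section
/- Bidirectional signalling in the quantum switch (operative content of the paper's no-go lemma for the quantum switch): Let α β : ℂ and define, for unit vectors ψT, ψA, ψB : Fin 2 → ℂ, the amplitude Φ[ψT,ψA,ψB] c f u v := if c = 0 then α * ψB f * ψT u * ψA v else β * ψA f * ψB u * ψT v and the B_I-marginal ρB[ψT,ψA,ψB] x y := ∑_{c,f,u} Φ c f u x * conj (Φ c f u y) and the A_I-marginal ρA[ψT,ψA,ψB] u u' := ∑_{c,f,v} Φ c f u v * conj (Φ c f u' v). If α ≠ 0, then for every pair of unit vectors ψT, ψB there exist unit vectors ψA, ψA' : Fin 2 → ℂ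 such that ρB[ψT,ψA,ψB] ≠ ρB[ψT,ψA',ψB] (so A_O signals to B_I in the quantum-switch process map); and if β ≠ 0, then for every pair of unit vectors ψT, ψA there exist unit vectors ψB, ψB' such that ρA[ψT,ψA,ψB] ≠ ρA[ψT,ψA,ψB'] (so B_O signals to A_I). -/
noncomputable section

/-- A unit vector of a qubit. -/
def IsUnitVec (v : Fin 2 → ℂ) : Prop := ∑ i, Complex.normSq (v i) = 1

/-- Amplitude of the state `Ŵ^{QS}|Ψ⟩` on the systems `F^C, F^T, A_I, B_I` when the input
of the quantum-switch process map is `(α|0⟩+β|1⟩) ⊗ ψT ⊗ ψA ⊗ ψB`. -/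
def switchAmp (α β : ℂ) (ψT ψA ψB : Fin 2 → ℂ) (c f u v : Fin 2) : ℂ :=
  if c = 0 then α * ψB f * ψT u * ψA v else β * ψA f * ψB u * ψT v

/-- The reduced state (marginal) on `B_I` of `|Φ⟩⟨Φ|`. -/
def ρBmarg (α β : ℂ) (ψT ψA ψB : Fin 2 → ℂ) (x y : Fin 2) : ℂ :=
  ∑ c : Fin 2, ∑ f : Fin 2, ∑ u : Fin 2,
    switchAmp α β ψT ψA ψB c f u x * (starRingEnd ℂ) (switchAmp α β ψT ψA ψB c f u y)

/-- The reduced state (marginal) on `A_I` of `|Φ⟩⟨Φ|`. -/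
def ρAmarg (α β : ℂ) (ψT ψA ψB : Fin 2 → ℂ) (u u' : Fin 2) : ℂ :=
  ∑ c : Fin 2, ∑ f : Fin 2, ∑ v : Fin 2,
    switchAmp α β ψT ψA ψB c f u v * (starRingEnd ℂ) (switchAmp α β ψT ψA ψB c f u' v)

theorem IsUnitVec.sum_mul_conj {v : Fin 2 → ℂ} (hv : IsUnitVec v) :
    v 0 * starRingEnd ℂ (v 0) + v 1 * starRingEnd ℂ (v 1) = 1 := by
  rw [Complex.mul_conj, Complex.mul_conj, ← Complex.ofReal_add, ← Fin.sum_univ_two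
    (fun i => Complex.normSq (v i)), hv, Complex.ofReal_one]

theorem isUnitVec_single (i : Fin 2) : IsUnitVec (Pi.single i 1) := by
  fin_cases i <;> simp [IsUnitVec]

/-- The marginal on `B_I` is the mixture of the inputs to `A_O` and `P^T`
with weights `|α|²` and `|β|²`. -/
theorem ρBmarg_eq (α β : ℂ) {ψT ψA ψB : Fin 2 → ℂ} (hT : IsUnitVec ψT) (hA : IsUnitVec ψA)
    (hB : IsUnitVec ψB) (x y : Fin 2) :
    ρBmarg α β ψT ψA ψB x y =
      α * starRingEnd ℂ α * (ψA x * starRingEnd ℂ (ψA y)) +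
        β * starRingEnd ℂ β * (ψT x * starRingEnd ℂ (ψT y)) := by
  simp only [ρBmarg, switchAmp, Fin.sum_univ_two, if_true, one_ne_zero, if_false, map_mul]
  have hT := hT.sum_mul_conj
  have hA := hA.sum_mul_conj
  have hB := hB.sum_mul_conj
  linear_combination
    α * starRingEnd ℂ α * (ψA x * starRingEnd ℂ (ψA y)) *
      ((ψT 0 * starRingEnd ℂ (ψT 0) + ψT 1 * starRingEnd ℂ (ψT 1)) * hB + hT) +
    β * starRingEnd ℂ β * (ψT x * starRingEnd ℂ (ψT y)) *
      ((ψA 0 * starRingEnd ℂ (ψA 0) + ψA 1 * starRingEnd ℂ (ψA 1)) * hB + hA)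

/-- The switch is symmetric under exchanging the two laboratories and the two control states. -/
theorem ρAmarg_eq_ρBmarg (α β : ℂ) (ψT ψA ψB : Fin 2 → ℂ) :
    ρAmarg α β ψT ψA ψB = ρBmarg β α ψT ψB ψA := by
  ext u u'
  simp only [ρAmarg, ρBmarg, switchAmp, Fin.sum_univ_two, if_true, one_ne_zero, if_false, map_mul]
  ring

theorem exists_ρBmarg_ne {α : ℂ} (β : ℂ) (hα : α ≠ 0) {ψT ψB : Fin 2 → ℂ} (hT : IsUnitVec ψT)
    (hB : IsUnitVec ψB) :
    ∃ ψA ψA' : Fin 2 → ℂ, IsUnitVec ψA ∧ IsUnitVec ψA' ∧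
      ρBmarg α β ψT ψA ψB ≠ ρBmarg α β ψT ψA' ψB := by
  refine ⟨_, _, isUnitVec_single 0, isUnitVec_single 1, fun h => hα ?_⟩
  have h00 := congrFun (congrFun h 0) 0
  rw [ρBmarg_eq α β hT (isUnitVec_single 0) hB, ρBmarg_eq α β hT (isUnitVec_single 1) hB] at h00
  simpa using h00

/-- **Bidirectional signalling in the quantum switch** (operative content of Lemma 7):
whenever `α ≠ 0`, for every choice of unit vectors on the target and on `B_O` there are
two unit vectors Alice can feed into `A_O` producing different reduced states on `B_I`
(so `A_O` signals to `B_I`); symmetrically, whenever `β ≠ 0`, `B_O` signals to `A_I`. -/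
theorem switch_bidirectional_signalling (α β : ℂ) :
    (α ≠ 0 → ∀ ψT ψB : Fin 2 → ℂ, IsUnitVec ψT → IsUnitVec ψB →
      ∃ ψA ψA' : Fin 2 → ℂ, IsUnitVec ψA ∧ IsUnitVec ψA' ∧
        ρBmarg α β ψT ψA ψB ≠ ρBmarg α β ψT ψA' ψB) ∧
    (β ≠ 0 → ∀ ψT ψA : Fin 2 → ℂ, IsUnitVec ψT → IsUnitVec ψA →
      ∃ ψB ψB' : Fin 2 → ℂ, IsUnitVec ψB ∧ IsUnitVec ψB' ∧
        ρAmarg α β ψT ψA ψB ≠ ρAmarg α β ψT ψA ψB') := by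
  refine ⟨fun hα _ _ hT hB => exists_ρBmarg_ne β hα hT hB, fun hβ _ _ hT hA => ?_⟩
  simp only [ρAmarg_eq_ρBmarg]
  exact exists_ρBmarg_ne α hβ hT hA
end
end

section
/- Contraction identity for the quantum-switch process vector (Equation (17) of the paper): Define W8 : Fin 2 → Fin 2 → Fin 2 → Fin 2 → Fin 2 → Fin 2 → Fin 2 → Fin 2 → ℂ by W8 c t ai ao bi bo dc dt := (if c = 0 ∧ dc = 0 ∧ t = ai ∧ ao = bi ∧ bo = dt then 1 else 0) + (if c = 1 ∧ dc = 1 ∧ t = bi ∧ bo = ai ∧ ao = dt then 1 else 0), the coefficient function of the process vector |W^{QS}⟩ = |𝟙⟩⟩^{C_O^T A_I}|𝟙⟩⟩^{A_O B_I}|𝟙⟩⟩^{B_O D_I^T}|00⟩^{C_O^C D_I^C} + |𝟙⟩⟩^{C_O^T B_I}|𝟙⟩⟩^{B_O A_I}|𝟙⟩⟩^{A_O D_I^T}|11⟩^{C_O^C D_I^C}. Then for all α β : ℂ, every ψ : Fin 2 → ℂ, all matrices U V : Matrix (Fin 2) (Fin 2) ℂ, and all dc dt : Fin 2, ∑_{c,t,ai,ao,bi,bo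 : Fin 2} (if c = 0 then α else β) * ψ t * U ao ai * V bo bi * W8 c t ai ao bi bo dc dt = if dc = 0 then α * ((V * U).mulVec ψ) dt else β * ((U * V).mulVec ψ) dt. That is, contracting the process vector with the input state (α⟨0|+β⟨1|) ⊗ ⟨ψ*| and the Choi vectors of the local operations U and V yields α|0⟩ ⊗ (V U ψ) + β|1⟩ ⊗ (U V ψ) on D_I^C ⊗ D_I^T. -/
noncomputable section

/-- Coefficient function of the quantum-switch process vector
`|W^{QS}⟩ = |𝟙⟩⟩^{C_O^T A_I}|𝟙⟩⟩^{A_O B_I}|𝟙⟩⟩^{B_O D_I^T}|00⟩^{C_O^C D_I^C}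
          + |𝟙⟩⟩^{C_O^T B_I}|𝟙⟩⟩^{B_O A_I}|𝟙⟩⟩^{A_O D_I^T}|11⟩^{C_O^C D_I^C}`
in the computational product basis of the eight qubit systems. -/
def W8 (c t ai ao bi bo dc dt : Fin 2) : ℂ :=
  (if c = 0 ∧ dc = 0 ∧ t = ai ∧ ao = bi ∧ bo = dt then 1 else 0) +
  (if c = 1 ∧ dc = 1 ∧ t = bi ∧ bo = ai ∧ ao = dt then 1 else 0)

/-- **Contraction identity for the quantum-switch process vector (Equation (17)).**
Contracting the process vector with the input state `(α⟨0|+β⟨1|) ⊗ ⟨ψ*|` and the Choi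
vectors of the local operations `U` and `V` yields
`α|0⟩ ⊗ (V U ψ) + β|1⟩ ⊗ (U V ψ)` on `D_I^C ⊗ D_I^T`. -/
theorem switch_process_vector_contraction
    (α β : ℂ) (ψ : Fin 2 → ℂ) (U V : Matrix (Fin 2) (Fin 2) ℂ) (dc dt : Fin 2) :
    (∑ c : Fin 2, ∑ t : Fin 2, ∑ ai : Fin 2, ∑ ao : Fin 2, ∑ bi : Fin 2, ∑ bo : Fin 2,
      (if c = 0 then α else β) * ψ t * U ao ai * V bo bi * W8 c t ai ao bi bo dc dt)
    = if dc = 0 then α * ((V * U).mulVec ψ) dt else β * ((U * V).mulVec ψ) dt := by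
  fin_cases dc <;> fin_cases dt <;>
    simp [W8, Fin.sum_univ_two, Matrix.mulVec, dotProduct, Matrix.mul_apply] <;> ring
end
end
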